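/- Let (Ω, μ) be a finite measure space, let ε > 0, and let o : Ω → ℝ be a bounded measurable function. Define u* : Ω → ℝ by u*(x) = 1/(1 + exp(−o(x)/ε)). Then for every measurable u : Ω → ℝ with 0 ≤ u(x) ≤ 1 for all x, the functional J(u) = ∫_Ω [−o(x)·u(x) + ε·(u(x)·log u(x) + (1−u(x))·log(1−u(x)))] dμ(x) (with the convention 0·log 0 = 0) satisfies J(u*) ≤ J(u); moreover, any measurable minimizer u of J with values in [0,1] equals u* μ-almost everywhere. -/

import Mathlib

open MeasureTheory

/-- Strict form of Gibbs' inequality for a single term. -/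
lemma sub_lt_mul_log_sub_mul_log {t p : ℝ} (ht : 0 ≤ t) (hp : 0 < p) (h : t ≠ p) :
    t - p < t * Real.log t - t * Real.log p := by
  rcases ht.eq_or_lt with rfl | ht
  · simpa using hp
  · have hne : p / t ≠ 1 := fun h' => h ((div_eq_one_iff_eq ht.ne').mp h').symm
    have hlog := mul_lt_mul_of_pos_left (Real.log_lt_sub_one_of_pos (div_pos hp ht) hne) ht
    rw [Real.log_div hp.ne' ht.ne', mul_sub, mul_sub, mul_div_cancel₀ _ ht.ne'] at hlog
    linarith

/-- Binary Gibbs' inequality, strict form. -/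
lemma binary_gibbs_lt {t p : ℝ} (ht : t ∈ Set.Icc (0 : ℝ) 1) (hp : p ∈ Set.Ioo (0 : ℝ) 1)
    (h : t ≠ p) :
    t * Real.log p + (1 - t) * Real.log (1 - p) <
      t * Real.log t + (1 - t) * Real.log (1 - t) := by
  have h₁ := sub_lt_mul_log_sub_mul_log ht.1 hp.1 h
  have h₂ := sub_lt_mul_log_sub_mul_log (sub_nonneg.mpr ht.2) (sub_pos.mpr hp.2)
    (fun h' => h (sub_right_injective h'))
  linarith

lemma one_div_one_add_exp_mem_Ioo (y : ℝ) : 1 / (1 + Real.exp y) ∈ Set.Ioo (0 : ℝ) 1 := by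
  have := Real.exp_pos y
  refine ⟨by positivity, ?_⟩
  rw [div_lt_one (by positivity)]
  linarith

lemma log_sub_log_one_sub_sigmoid (y : ℝ) :
    Real.log (1 / (1 + Real.exp y)) - Real.log (1 - 1 / (1 + Real.exp y)) = -y := by
  have h := Real.exp_pos y
  have h₁ : 1 - 1 / (1 + Real.exp y) = Real.exp y / (1 + Real.exp y) := by
    field_simp
    ring
  rw [h₁, Real.log_div (by positivity) (by positivity),
    Real.log_div (by positivity) (by positivity), Real.log_exp, Real.log_one]
  ring

/-- The sigmoid is the strict pointwise minimizer of the entropy-regularized linear energy. -/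
lemma sigmoid_energy_lt {ε : ℝ} (hε : 0 < ε) (a : ℝ) {s t : ℝ}
    (hs : s = 1 / (1 + Real.exp (-a / ε))) (ht : t ∈ Set.Icc (0 : ℝ) 1) (h : t ≠ s) :
    -a * s + ε * (s * Real.log s + (1 - s) * Real.log (1 - s)) <
      -a * t + ε * (t * Real.log t + (1 - t) * Real.log (1 - t)) := by
  have hmem : s ∈ Set.Ioo (0 : ℝ) 1 := hs ▸ one_div_one_add_exp_mem_Ioo _
  have hlog : Real.log s - Real.log (1 - s) = -(-a / ε) := hs ▸ log_sub_log_one_sub_sigmoid _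
  have ha : a = ε * (Real.log s - Real.log (1 - s)) := by
    rw [hlog]
    field_simp
  have hg := mul_lt_mul_of_pos_left (binary_gibbs_lt ht hmem h) hε
  generalize Real.log s = x at *
  generalize Real.log (1 - s) = y at *
  subst ha
  linarith

lemma integrable_energy {Ω : Type*} [MeasurableSpace Ω] (μ : Measure Ω) [IsFiniteMeasure μ]
    (ε : ℝ) {o u : Ω → ℝ} (ho : Measurable o) {C : ℝ} (hC : ∀ x, |o x| ≤ C)
    (hu : Measurable u) (hu' : ∀ x, u x ∈ Set.Icc (0 : ℝ) 1) :
    Integrable (fun x => -(o x) * u x + ε * (u x * Real.log (u x)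
      + (1 - u x) * Real.log (1 - u x))) μ := by
  have hlin : Integrable (fun x => -(o x) * u x) μ := by
    refine .of_bound (ho.neg.mul hu).aestronglyMeasurable C (.of_forall fun x => ?_)
    rw [Real.norm_eq_abs, abs_mul, abs_neg, abs_of_nonneg (hu' x).1]
    exact (mul_le_of_le_one_right (abs_nonneg _) (hu' x).2).trans (hC x)
  have hent : Integrable (fun x => Real.binEntropy (u x)) μ := by
    refine .of_bound (Real.binEntropy_continuous.measurable.comp hu).aestronglyMeasurable
      (Real.log 2) (.of_forall fun x => ?_)
    rw [Real.norm_eq_abs, abs_of_nonneg (Real.binEntropy_nonneg (hu' x).1 (hu' x).2)]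
    exact Real.binEntropy_le_log_two
  refine (hlin.sub (hent.const_mul ε)).congr (.of_forall fun x => ?_)
  simp only [Pi.sub_apply, Real.binEntropy, Real.log_inv]
  ring

/-- Functional form of the variational explanation of the sigmoid layer: on a finite
measure space, with `ε > 0` and `o` bounded measurable, the function
`u*(x) = 1/(1 + exp(-o(x)/ε))` minimizes
`J(u) = ∫ (-o·u + ε·(u·log u + (1-u)·log(1-u))) dμ` over all measurable `u` with
values in `[0,1]` (the convention `0·log 0 = 0` holds since `Real.log 0 = 0`);
moreover, any such minimizer equals `u*` μ-a.e. -/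
theorem sigmoid_variational_functional {Ω : Type*} [MeasurableSpace Ω]
    (μ : Measure Ω) [IsFiniteMeasure μ] (ε : ℝ) (hε : 0 < ε)
    (o : Ω → ℝ) (ho : Measurable o) (hob : ∃ C : ℝ, ∀ x, |o x| ≤ C) :
    (∀ u : Ω → ℝ, Measurable u → (∀ x, u x ∈ Set.Icc (0 : ℝ) 1) →
      (∫ x, (-(o x) * (1 / (1 + Real.exp (-(o x) / ε)))
          + ε * ((1 / (1 + Real.exp (-(o x) / ε)))
                  * Real.log (1 / (1 + Real.exp (-(o x) / ε)))
              + (1 - 1 / (1 + Real.exp (-(o x) / ε)))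
                  * Real.log (1 - 1 / (1 + Real.exp (-(o x) / ε))))) ∂μ) ≤
      ∫ x, (-(o x) * u x + ε * (u x * Real.log (u x)
              + (1 - u x) * Real.log (1 - u x))) ∂μ) ∧
    (∀ u : Ω → ℝ, Measurable u → (∀ x, u x ∈ Set.Icc (0 : ℝ) 1) →
      (∀ v : Ω → ℝ, Measurable v → (∀ x, v x ∈ Set.Icc (0 : ℝ) 1) →
        (∫ x, (-(o x) * u x + ε * (u x * Real.log (u x)
                + (1 - u x) * Real.log (1 - u x))) ∂μ) ≤
        ∫ x, (-(o x) * v x + ε * (v x * Real.log (v x)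
                + (1 - v x) * Real.log (1 - v x))) ∂μ) →
      u =ᵐ[μ] fun x => 1 / (1 + Real.exp (-(o x) / ε))) := by
  obtain ⟨C, hC⟩ := hob
  have hs : Measurable fun x => 1 / (1 + Real.exp (-(o x) / ε)) := by fun_prop
  have hs' : ∀ x, 1 / (1 + Real.exp (-(o x) / ε)) ∈ Set.Icc (0 : ℝ) 1 :=
    fun x => Set.Ioo_subset_Icc_self (one_div_one_add_exp_mem_Ioo _)
  have hsi := integrable_energy μ ε ho hC hs hs'
  have hle : ∀ u : Ω → ℝ, (∀ x, u x ∈ Set.Icc (0 : ℝ) 1) → ∀ x, _ ≤ _ := fun u hu' x =>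
    (eq_or_ne (u x) _).elim (fun h => (congrArg (fun t => -(o x) * t + ε * (t * Real.log t
      + (1 - t) * Real.log (1 - t))) h).ge) (fun h => (sigmoid_energy_lt hε (o x) rfl (hu' x) h).le)
  refine ⟨fun u hu hu' => integral_mono hsi (integrable_energy μ ε ho hC hu hu') (hle u hu'),
    fun u hu hu' hmin => ?_⟩
  have hui := integrable_energy μ ε ho hC hu hu'
  have heq := (integral_eq_iff_of_ae_le hsi hui (.of_forall (hle u hu'))).mp
    (le_antisymm (integral_mono hsi hui (hle u hu')) (hmin _ hs hs'))
  filter_upwards [heq] with x hx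
  by_contra h
  exact (sigmoid_energy_lt hε (o x) rfl (hu' x) h).ne hx
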